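/- Let p be a prime with p > 3, and let b be a p-integer with ⟨b⟩_p ≠ 0 and ⟨b⟩_p < p/3. Set s = (b − ⟨b⟩_p)/p and assume s ≢ −1 (mod p). Then Σ_{k=0}^{p−1} C(2k,k)·C(3k,k) / (27^k (k + b)) ≡ (−1)^{⟨b⟩_p} · p·(s + 1/3)(s + 2/3) / ( b²·(s + 1)·C(2⟨b⟩_p, ⟨b⟩_p)·C(⌊p/3⌋ + ⟨b⟩_p, ⌊p/3⌋ − ⟨b⟩_p) ) (mod p²). -/

import Mathlib

/-- A rational number is a `p`-integer if its denominator (in lowest terms)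
is not divisible by `p`. -/
def isPInt (p : ℕ) (x : ℚ) : Prop := ¬ p ∣ x.den

/-- For `p`-integers `u, v`, `u ≡ v (mod p^k)` means `(u - v)/p^k` is a `p`-integer. -/
def pCong (p k : ℕ) (u v : ℚ) : Prop := isPInt p ((u - v) / (p : ℚ) ^ k)

/-- The ring of `p`-integers. -/
def pIntegers (p : ℕ) (hp : p.Prime) : Subring ℚ where
  carrier := {x | isPInt p x}
  mul_mem' := fun {x y} hx hy h =>
    ((hp.dvd_mul).1 (h.trans (Rat.mul_den_dvd x y))).elim hx hy
  one_mem' := by simpa [isPInt] using hp.one_lt.ne'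
  add_mem' := fun {x y} hx hy h =>
    ((hp.dvd_mul).1 (h.trans (Rat.add_den_dvd x y))).elim hx hy
  zero_mem' := by simpa [isPInt] using hp.one_lt.ne'
  neg_mem' := fun {x} hx => by simpa [isPInt] using hx

section pIntegers

variable {p : ℕ} {hp : p.Prime}

theorem mem_pIntegers {x : ℚ} : x ∈ pIntegers p hp ↔ isPInt p x := Iff.rfl

theorem inv_mem_pIntegers_of_not_dvd_num {x : ℚ} (h : ¬ (p : ℤ) ∣ x.num) :
    x⁻¹ ∈ pIntegers p hp := by
  have hx : x ≠ 0 := by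
    rintro rfl
    simp at h
  have hn : x.num ≠ 0 := Rat.num_ne_zero.2 hx
  rw [mem_pIntegers, isPInt, Rat.den_inv_of_ne_zero hx]
  rwa [← Int.natCast_dvd]

theorem inv_intCast_mem_pIntegers {n : ℤ} (h : ¬ (p : ℤ) ∣ n) :
    (n : ℚ)⁻¹ ∈ pIntegers p hp :=
  inv_mem_pIntegers_of_not_dvd_num (by simpa using h)

theorem inv_natCast_mem_pIntegers {n : ℕ} (h : ¬ p ∣ n) :
    (n : ℚ)⁻¹ ∈ pIntegers p hp := by
  have := inv_intCast_mem_pIntegers (hp := hp) (n := n) (by exact_mod_cast h)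
  simpa using this

/-- A `p`-integer that is not a multiple of `p` is a unit. -/
theorem inv_mem_pIntegers {x : ℚ} (hx : x ∈ pIntegers p hp)
    (h : x / p ∉ pIntegers p hp) : x⁻¹ ∈ pIntegers p hp := by
  refine inv_mem_pIntegers_of_not_dvd_num fun ⟨c, hc⟩ => h ?_
  have hp0 : (p : ℚ) ≠ 0 := Nat.cast_ne_zero.2 hp.ne_zero
  have hd : (x.den : ℚ)⁻¹ ∈ pIntegers p hp := inv_natCast_mem_pIntegers hx
  have hxc : x / p = c * (x.den : ℚ)⁻¹ := by
    conv_lhs => rw [← Rat.num_div_den x, hc]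
    push_cast
    field_simp
  rw [hxc]
  exact mul_mem (intCast_mem _ c) hd

theorem dvd_of_div_mem_pIntegers {n : ℤ} (h : (n : ℚ) / p ∈ pIntegers p hp) : (p : ℤ) ∣ n := by
  by_contra hn
  have hp0 : (p : ℚ) ≠ 0 := Nat.cast_ne_zero.2 hp.ne_zero
  have hn0 : (n : ℚ) ≠ 0 := by
    rintro h0
    exact hn (by simp [Int.cast_eq_zero.1 h0])
  have h1 : (p : ℚ)⁻¹ ∈ pIntegers p hp := by
    have := mul_mem h (inv_intCast_mem_pIntegers (hp := hp) hn)
    rwa [show (n : ℚ) / p * (n : ℚ)⁻¹ = (p : ℚ)⁻¹ by field_simp] at this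
  rw [mem_pIntegers, isPInt, Rat.inv_natCast_den_of_pos hp.pos] at h1
  exact h1 dvd_rfl

/-- A `p`-integer congruent to an integer prime to `p` is nonzero and invertible. -/
theorem inv_intCast_add_mul_mem_pIntegers {n : ℤ} {s : ℚ} (hs : s ∈ pIntegers p hp)
    (hn : ¬ (p : ℤ) ∣ n) :
    (n : ℚ) + p * s ≠ 0 ∧ ((n : ℚ) + p * s)⁻¹ ∈ pIntegers p hp := by
  have hp0 : (p : ℚ) ≠ 0 := Nat.cast_ne_zero.2 hp.ne_zero
  have key : ((n : ℚ) + p * s) / p ∉ pIntegers p hp := fun h => hn <| by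
    refine dvd_of_div_mem_pIntegers (hp := hp) ?_
    have := sub_mem h hs
    rwa [show ((n : ℚ) + p * s) / p - s = n / p by field_simp; ring] at this
  refine ⟨fun h => key ?_, inv_mem_pIntegers ?_ key⟩
  · rw [h, zero_div]
    exact zero_mem _
  · exact add_mem (intCast_mem _ n) (mul_mem (natCast_mem _ p) hs)

theorem inv_choose_mem_pIntegers {n k : ℕ} (hk : k ≤ n) (hn : n < p) :
    ((n.choose k : ℕ) : ℚ)⁻¹ ∈ pIntegers p hp := by
  refine inv_natCast_mem_pIntegers fun h => ?_
  have h1 : p ∣ n.factorial := by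
    rw [← Nat.choose_mul_factorial_mul_factorial hk, mul_assoc]
    exact h.mul_right _
  exact absurd ((hp.dvd_factorial).1 h1) (by lia)

end pIntegers

/-- The coefficient `C(2k,k) C(3k,k) / 27^k`. -/
def cubicCoeff (k : ℕ) : ℚ := ((2 * k).choose k : ℚ) * ((3 * k).choose k : ℚ) / 27 ^ k

theorem cubicCoeff_succ (k : ℕ) :
    ((k : ℚ) + 1) ^ 2 * cubicCoeff (k + 1) = (k + 1 / 3) * (k + 2 / 3) * cubicCoeff k := by
  have h (k : ℕ) : cubicCoeff k = ((3 * k).factorial : ℚ) / ((k.factorial : ℚ) ^ 3 * 27 ^ k) := by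
    have h2 : 2 * k - k = k := by lia
    have h3 : 3 * k - k = 2 * k := by lia
    have f1 : (k.factorial : ℚ) ≠ 0 := by positivity
    have f2 : ((2 * k).factorial : ℚ) ≠ 0 := by positivity
    rw [cubicCoeff, Nat.cast_choose ℚ (by lia : k ≤ 2 * k), Nat.cast_choose ℚ (by lia : k ≤ 3 * k),
      h2, h3]
    field_simp
  have f1 : (k.factorial : ℚ) ≠ 0 := by positivity
  have f2 : ((k : ℚ) + 1) ≠ 0 := by positivity
  rw [h, h, show 3 * (k + 1) = 3 * k + 1 + 1 + 1 by ring, Nat.factorial_succ, Nat.factorial_succ,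
    Nat.factorial_succ, Nat.factorial_succ]
  push_cast
  field_simp
  ring

/-- The truncated sum `∑_{k<p} C(2k,k) C(3k,k) / (27^k (k + b))`. -/
def cubicSum (p : ℕ) (b : ℚ) : ℚ := ∑ k ∈ Finset.range p, cubicCoeff k / (k + b)

/-- A telescoping recurrence for `cubicSum` in the shift `b`. -/
theorem cubicSum_add_one (p : ℕ) (hp : 0 < p) (b : ℚ) (hb : ∀ k < p, (k : ℚ) + (b + 1) ≠ 0) :
    (b + 1 - 1 / 3) * (b + 1 - 2 / 3) * cubicSum p (b + 1)
      = b ^ 2 * cubicSum p b + p ^ 2 * (cubicCoeff p / (p + b)) := by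
  have key : ∀ m ≤ p, 0 < m → (b + 1 - 1 / 3) * (b + 1 - 2 / 3) * cubicSum m (b + 1)
      = b ^ 2 * cubicSum m b + m ^ 2 * (cubicCoeff m / (m + b)) := by
    intro m hm h0
    induction m, h0 using Nat.le_induction with
    | base =>
      have hb0 : b + 1 ≠ 0 := by simpa using hb 0 (by lia)
      have hb1 : 1 + b ≠ 0 := by rwa [add_comm]
      have h1 : cubicCoeff 1 = 2 / 9 := by norm_num [cubicCoeff]
      have h0 : cubicCoeff 0 = 1 := by norm_num [cubicCoeff]
      simp only [cubicSum, zero_add, Finset.sum_range_one, h0, h1, Nat.cast_zero, Nat.cast_one]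
      have : b ^ 2 * (1 / b) = b := by
        rcases eq_or_ne b 0 with rfl | h
        · simp
        · field_simp
      rw [this]
      field_simp
      ring
    | succ m h0 ih =>
      have ih := ih (by lia)
      have hm0 : (m : ℚ) + (b + 1) ≠ 0 := hb m (by lia)
      have hm1 : (m : ℚ) + b ≠ 0 := by
        have := hb (m - 1) (by lia)
        rw [Nat.cast_sub h0] at this
        intro h
        apply this
        push_cast
        linarith
      have hm2 : (m : ℚ) + 1 + b ≠ 0 := by rwa [add_assoc, add_comm 1 b]
      have hs := cubicCoeff_succ m
      simp only [cubicSum] at ih ⊢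
      rw [Finset.sum_range_succ, Finset.sum_range_succ, mul_add, ih, mul_add]
      push_cast
      rw [← mul_div_assoc, ← mul_div_assoc (((m : ℚ) + 1) ^ 2), hs]
      field_simp
      ring
  exact key p le_rfl hp

theorem cubicCoeff_mem_pIntegers {p : ℕ} {hp : p.Prime} (hp3 : 3 < p) (k : ℕ) :
    cubicCoeff k ∈ pIntegers p hp := by
  have h27 : ((27 ^ k : ℕ) : ℚ)⁻¹ ∈ pIntegers p hp := inv_natCast_mem_pIntegers fun h => by
    have := (Nat.prime_dvd_prime_iff_eq hp Nat.prime_three).1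
      (hp.dvd_of_dvd_pow ((by norm_num : 27 = 3 ^ 3) ▸ hp.dvd_of_dvd_pow h))
    lia
  rw [cubicCoeff, div_eq_mul_inv]
  push_cast at h27
  exact mul_mem (mul_mem (natCast_mem _ _) (natCast_mem _ _)) h27

theorem cubicCoeff_prime {p : ℕ} {hp : p.Prime} (hp3 : 3 < p) :
    ∃ r ∈ pIntegers p hp, cubicCoeff p = 2 / 9 + p * r := by
  have : Fact p.Prime := ⟨hp⟩
  have lucas (m : ℕ) : (m * p).choose p ≡ m [MOD p] := by
    have := Choose.choose_modEq_choose_mod_mul_choose_div_nat (n := m * p) (k := p) (p := p)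
    simpa [Nat.mul_div_cancel _ hp.pos, Nat.div_self hp.pos] using this
  have hz : ((p : ℕ) : ℤ) ∣ 9 * ((2 * p).choose p * (3 * p).choose p) - 2 * 27 ^ p := by
    rw [← ZMod.intCast_zmod_eq_zero_iff_dvd]
    have l2 := (ZMod.natCast_eq_natCast_iff _ _ _).2 (lucas 2)
    have l3 := (ZMod.natCast_eq_natCast_iff _ _ _).2 (lucas 3)
    push_cast
    rw [l2, l3, ZMod.pow_card]
    norm_num
  obtain ⟨c, hc⟩ := hz
  have hc' : (9 : ℚ) * ((2 * p).choose p * (3 * p).choose p) - 2 * 27 ^ p = p * c := by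
    exact_mod_cast hc
  have h27 : ((9 * 27 ^ p : ℕ) : ℚ)⁻¹ ∈ pIntegers p hp := inv_natCast_mem_pIntegers fun h => by
    rw [show 9 * 27 ^ p = 3 ^ (2 + 3 * p) by rw [pow_add, pow_mul]; norm_num] at h
    have := (Nat.prime_dvd_prime_iff_eq hp Nat.prime_three).1 (hp.dvd_of_dvd_pow h)
    lia
  refine ⟨c * ((9 * 27 ^ p : ℕ) : ℚ)⁻¹, mul_mem (intCast_mem _ _) h27, ?_⟩
  rw [cubicCoeff]
  push_cast
  rw [← mul_assoc, ← hc']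
  field_simp
  ring

/-- The product `C(2B,B) C(n+B,n-B)`. -/
def binomProd (n B : ℕ) : ℚ := ((2 * B).choose B : ℚ) * ((n + B).choose (n - B) : ℚ)

theorem binomProd_succ {n B : ℕ} (h : B < n) :
    ((B : ℚ) + 1) ^ 2 * binomProd n (B + 1) = binomProd n B * ((n + B + 1) * (n - B)) := by
  obtain ⟨m, rfl⟩ : ∃ m, n = m + B + 1 := ⟨n - B - 1, by lia⟩
  have h (n B : ℕ) (h : B ≤ n) :
      binomProd n B = ((n + B).factorial : ℚ) / ((n - B).factorial * (B.factorial : ℚ) ^ 2) := by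
    have h2 : 2 * B - B = B := by lia
    have h3 : n + B - (n - B) = 2 * B := by lia
    have f2 : ((2 * B).factorial : ℚ) ≠ 0 := by positivity
    rw [binomProd, Nat.cast_choose ℚ (by lia : B ≤ 2 * B),
      Nat.cast_choose ℚ (by lia : n - B ≤ n + B), h2, h3]
    field_simp
  rw [h _ _ (by lia), h _ _ (by lia), show m + B + 1 - (B + 1) = m by lia,
    show m + B + 1 - B = m + 1 by lia, show m + B + 1 + (B + 1) = m + B + 1 + B + 1 by ring,
    Nat.factorial_succ (m + B + 1 + B), Nat.factorial_succ B, Nat.factorial_succ m]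
  push_cast
  field_simp
  ring

theorem binomProd_mem_pIntegers {p : ℕ} {hp : p.Prime} (n B : ℕ) :
    binomProd n B ∈ pIntegers p hp :=
  mul_mem (natCast_mem _ _) (natCast_mem _ _)

theorem inv_binomProd_mem_pIntegers {p : ℕ} {hp : p.Prime} {n B : ℕ} (h : B ≤ n)
    (hn : n + B < p) : (binomProd n B)⁻¹ ∈ pIntegers p hp := by
  rw [binomProd, mul_inv]
  exact mul_mem (inv_choose_mem_pIntegers (by lia) (by lia))
    (inv_choose_mem_pIntegers (by lia) hn)

theorem binomProd_ne_zero {n B : ℕ} (h : B ≤ n) : binomProd n B ≠ 0 := by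
  have h1 : 0 < (2 * B).choose B := Nat.choose_pos (by lia)
  have h2 : 0 < (n + B).choose (n - B) := Nat.choose_pos (by lia)
  rw [binomProd]
  positivity

theorem third_mem_pIntegers {p : ℕ} {hp : p.Prime} (hp3 : 3 < p) :
    (1 / 3 : ℚ) ∈ pIntegers p hp := by
  have := inv_natCast_mem_pIntegers (hp := hp) (n := 3) fun h =>
    absurd (Nat.le_of_dvd (by norm_num) h) (by lia)
  rw [one_div]
  exact_mod_cast this

/-- `x = ⌊p/3⌋` solves `x(x+1) ≡ -2/9 (mod p)`. -/
theorem div_three_mul_add_one {p : ℕ} {hp : p.Prime} (hp3 : 3 < p) :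
    ∃ r ∈ pIntegers p hp, ((p / 3 : ℕ) : ℚ) * ((p / 3 : ℕ) + 1) = -(2 / 9) + p * r := by
  have h3 := third_mem_pIntegers (hp := hp) hp3
  have hmod : p % 3 ≠ 0 := fun h => by
    have := (Nat.prime_dvd_prime_iff_eq Nat.prime_three hp).1 (Nat.dvd_of_mod_eq_zero h)
    lia
  have hdm := Nat.div_add_mod p 3
  have hr : p % 3 = 1 ∨ p % 3 = 2 := by lia
  generalize p / 3 = n at *
  rcases hr with h | h
  · refine ⟨(1 / 3) * (1 / 3) * (p + 1 : ℕ), mul_mem (mul_mem h3 h3) (natCast_mem _ _), ?_⟩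
    have : (p : ℚ) = 3 * n + 1 := by rw [← hdm, h]; push_cast; ring
    push_cast
    rw [this]
    ring
  · refine ⟨(1 / 3) * (1 / 3) * (p - 1 : ℤ), mul_mem (mul_mem h3 h3) (intCast_mem _ _), ?_⟩
    have : (p : ℚ) = 3 * n + 2 := by rw [← hdm, h]; push_cast; ring
    push_cast
    rw [this]
    ring

theorem inv_quadratic_mem_pIntegers {p : ℕ} {hp : p.Prime} {B : ℕ} (hB0 : 0 < B)
    (hB : 3 * B < p) {s : ℚ} (hs : s ∈ pIntegers p hp) :
    (((B : ℚ) + p * s - 1 / 3) * (B + p * s - 2 / 3)) ≠ 0 ∧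
      (((B : ℚ) + p * s - 1 / 3) * (B + p * s - 2 / 3))⁻¹ ∈ pIntegers p hp := by
  have h3s : 3 * s ∈ pIntegers p hp := mul_mem (ofNat_mem _ 3) hs
  have h1 := inv_intCast_add_mul_mem_pIntegers (n := 3 * B - 1) h3s fun h => by
    have := Int.le_of_dvd (by lia) h
    lia
  have h2 := inv_intCast_add_mul_mem_pIntegers (n := 3 * B - 2) h3s fun h => by
    have := Int.le_of_dvd (by lia) h
    lia
  have e : ((B : ℚ) + p * s - 1 / 3) * (B + p * s - 2 / 3)
      = (((3 * B - 1 : ℤ) : ℚ) + p * (3 * s)) * (((3 * B - 2 : ℤ) : ℚ) + p * (3 * s)) / 9 := by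
    push_cast
    ring
  rw [e]
  refine ⟨div_ne_zero (mul_ne_zero h1.1 h2.1) (by norm_num), ?_⟩
  rw [inv_div, div_eq_mul_inv, mul_inv]
  exact mul_mem (ofNat_mem _ 9) (mul_mem h1.2 h2.2)

section congruence

variable {p : ℕ} {hp : p.Prime} {s w : ℚ}

theorem natCast_add_shift_ne_zero {B : ℕ} (hB0 : 0 < B) (hB : B < p) (hs : s ∈ pIntegers p hp)
    (hs1 : s + 1 ≠ 0) {k : ℕ} (hk : k < p) : (k : ℚ) + (B + p * s) ≠ 0 := by
  intro h
  have hp0 : (p : ℚ) ≠ 0 := Nat.cast_ne_zero.2 hp.ne_zero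
  by_cases hd : (p : ℤ) ∣ (k + B : ℕ)
  · have hd : p ∣ k + B := by exact_mod_cast hd
    obtain ⟨c, hc⟩ := hd
    have hc1 : c = 1 := by
      have : 0 < c := Nat.pos_of_ne_zero (by rintro rfl; lia)
      have : c < 2 := by
        by_contra! h2
        have := Nat.mul_le_mul_left p h2
        lia
      lia
    have : (k : ℚ) + B = p := by
      rw [hc1, mul_one] at hc
      exact_mod_cast hc
    apply hs1
    apply mul_left_cancel₀ hp0
    linarith
  · apply (inv_intCast_add_mul_mem_pIntegers hs hd).1
    push_cast
    linarith

theorem binomProd_mul_cubicSum_step (hp3 : 3 < p) (hs : s ∈ pIntegers p hp)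
    (hw : w ∈ pIntegers p hp) {B : ℕ} (hB : 3 * (B + 1) < p)
    (h : ∃ r ∈ pIntegers p hp,
      binomProd (p / 3) B * (((B + 1 : ℕ) + p * s - 1 / 3) * ((B + 1 : ℕ) + p * s - 2 / 3)
        * cubicSum p ((B + 1 : ℕ) + p * s)) = (-1) ^ B * p * w + p ^ 2 * r) :
    ∃ r ∈ pIntegers p hp,
      binomProd (p / 3) (B + 1) * (((B + 1 : ℕ) + p * s) ^ 2 * cubicSum p ((B + 1 : ℕ) + p * s))
        = (-1) ^ (B + 1) * p * w + p ^ 2 * r := by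
  obtain ⟨r1, hr1, h1⟩ := h
  obtain ⟨c, hc, hn⟩ := div_three_mul_add_one (hp := hp) hp3
  have hu := inv_quadratic_mem_pIntegers (hp := hp) (Nat.succ_pos B) hB hs
  have h2 := binomProd_succ (n := p / 3) (B := B) (by lia)
  have hD0 := binomProd_ne_zero (n := p / 3) (B := B) (by lia)
  have hD := inv_binomProd_mem_pIntegers (hp := hp) (n := p / 3) (B := B) (by lia) (by lia)
  have hDm := binomProd_mem_pIntegers (hp := hp) (p / 3) B
  have hDm' := binomProd_mem_pIntegers (hp := hp) (p / 3) (B + 1)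
  have hpm : (p : ℚ) ∈ pIntegers p hp := natCast_mem _ _
  have hBm : (B : ℚ) ∈ pIntegers p hp := natCast_mem _ _
  generalize binomProd (p / 3) B = D at *
  generalize binomProd (p / 3) (B + 1) = D' at *
  generalize ((p / 3 : ℕ) : ℚ) = n at *
  generalize cubicSum p _ = F at *
  simp only [Nat.succ_eq_add_one, Nat.cast_add, Nat.cast_one] at *
  set u := ((B : ℚ) + 1 + p * s - 1 / 3) * (B + 1 + p * s - 2 / 3) with hu_def
  have h1m : (1 : ℚ) ∈ pIntegers p hp := one_mem _
  have hεm : (-1 : ℚ) ^ B ∈ pIntegers p hp := pow_mem (neg_mem h1m) _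
  obtain ⟨r3, hr3, h4⟩ : ∃ r ∈ pIntegers p hp, F = p * r := by
    refine ⟨D⁻¹ * u⁻¹ * ((-1) ^ B * w + p * r1), mul_mem (mul_mem hD hu.2)
      (add_mem (mul_mem hεm hw) (mul_mem hpm hr1)), ?_⟩
    have hu0 := hu.1
    field_simp
    linear_combination h1
  have h2m : (2 : ℚ) ∈ pIntegers p hp := ofNat_mem _ 2
  have hr5 : 2 * (B + 1) * s + p * s * s ∈ pIntegers p hp :=
    add_mem (mul_mem (mul_mem h2m (add_mem hBm h1m)) hs) (mul_mem (mul_mem hpm hs) hs)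
  have hr2 : c + (2 * (B + 1) * s + p * s * s) - s ∈ pIntegers p hp :=
    sub_mem (add_mem hc hr5) hs
  refine ⟨-r1 + D * (c + (2 * (B + 1) * s + p * s * s) - s) * r3
    + D' * (2 * (B + 1) * s + p * s * s) * r3,
    add_mem (add_mem (neg_mem hr1) (mul_mem (mul_mem hDm hr2) hr3))
      (mul_mem (mul_mem hDm' hr5) hr3), ?_⟩
  have h3 : (n + B + 1) * (n - B) = -u + p * (c + (2 * (B + 1) * s + p * s * s) - s) := by
    rw [hu_def]
    linear_combination hn
  rw [h3] at h2
  rw [pow_succ]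
  linear_combination F * h2 - h1 + (D * p * (c + (2 * (B + 1) * s + p * s * s) - s)
    + D' * p * (2 * (B + 1) * s + p * s * s)) * h4

theorem sq_mul_cubicSum_mul_self (hp3 : 3 < p) (hs : s ∈ pIntegers p hp) :
    ∃ r ∈ pIntegers p hp, (p * s) ^ 2 * cubicSum p (p * s) = p * s + p ^ 2 * r := by
  have hp0 : (p : ℚ) ≠ 0 := Nat.cast_ne_zero.2 hp.ne_zero
  obtain ⟨q, hq⟩ : ∃ q, p = q + 1 := ⟨p - 1, by lia⟩
  refine ⟨s ^ 2 * ∑ k ∈ Finset.range q, cubicCoeff (k + 1) / ((k + 1 : ℕ) + p * s),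
    mul_mem (pow_mem hs 2) (sum_mem fun k hk => ?_), ?_⟩
  · rw [Finset.mem_range] at hk
    have := inv_intCast_add_mul_mem_pIntegers (n := (k + 1 : ℕ)) hs fun h => by
      have := Int.le_of_dvd (by lia) h
      lia
    rw [div_eq_mul_inv]
    exact mul_mem (cubicCoeff_mem_pIntegers hp3 _) (by simpa using this.2)
  · have h0 : cubicCoeff 0 = 1 := by norm_num [cubicCoeff]
    have h1 : cubicSum p (p * s) = 1 / (p * s)
        + ∑ k ∈ Finset.range q, cubicCoeff (k + 1) / ((k + 1 : ℕ) + p * s) := by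
      rw [cubicSum]
      conv_lhs => rw [show Finset.range p = Finset.range (q + 1) by rw [hq]]
      rw [Finset.sum_range_succ', h0, Nat.cast_zero, zero_add, add_comm]
    rw [h1]
    rcases eq_or_ne s 0 with rfl | h
    · simp
    · field_simp

theorem binomProd_mul_cubicSum (hp3 : 3 < p) (hs : s ∈ pIntegers p hp)
    (hs0 : s + 1 ≠ 0) (hs1 : (s + 1)⁻¹ ∈ pIntegers p hp) {B : ℕ} (hB0 : 0 < B)
    (hB : 3 * B < p) :
    ∃ r ∈ pIntegers p hp,
      binomProd (p / 3) B * ((B + p * s) ^ 2 * cubicSum p (B + p * s))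
        = (-1) ^ B * p * ((s + 1 / 3) * (s + 2 / 3) / (s + 1)) + p ^ 2 * r := by
  have hp0 : (p : ℚ) ≠ 0 := Nat.cast_ne_zero.2 hp.ne_zero
  have h3 := third_mem_pIntegers (hp := hp) hp3
  have hw : (s + 1 / 3) * (s + 2 / 3) / (s + 1) ∈ pIntegers p hp := by
    rw [div_eq_mul_inv, show (2 / 3 : ℚ) = 1 / 3 + 1 / 3 by norm_num]
    exact mul_mem (mul_mem (add_mem hs h3) (add_mem hs (add_mem h3 h3))) hs1
  have shift (B : ℕ) : ((B + 1 : ℕ) : ℚ) + p * s = B + p * s + 1 := by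
    push_cast
    ring
  have rec_eq {B : ℕ} (hB : B + 1 < p) := cubicSum_add_one p hp.pos (B + p * s) (fun k hk => by
    rw [← shift]
    exact natCast_add_shift_ne_zero (Nat.succ_pos B) hB hs hs0 hk)
  induction B, hB0 using Nat.le_induction with
  | base =>
    refine binomProd_mul_cubicSum_step hp3 hs hw (B := 0) (by lia) ?_
    have hrec := rec_eq (B := 0) (by lia)
    obtain ⟨r1, hr1, h1⟩ := sq_mul_cubicSum_mul_self hp3 hs
    obtain ⟨r2, hr2, h2⟩ := cubicCoeff_prime (hp := hp) hp3
    have hD : binomProd (p / 3) 0 = 1 := by simp [binomProd]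
    refine ⟨r1 + r2 * (s + 1)⁻¹, add_mem hr1 (mul_mem hr2 hs1), ?_⟩
    rw [shift, hrec, hD, Nat.cast_zero, zero_add, h1, h2,
      show (p : ℚ) + p * s = p * (s + 1) by ring]
    field_simp
    ring
  | succ B hB0 ih =>
    obtain ⟨r, hr, h⟩ := ih (by lia)
    refine binomProd_mul_cubicSum_step hp3 hs hw hB ?_
    have hrec := rec_eq (B := B) (by lia)
    have hunit := inv_intCast_add_mul_mem_pIntegers (n := (p + B : ℕ)) hs fun hd => by
      have hd : p ∣ p + B := by exact_mod_cast hd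
      have := Nat.le_of_dvd (by lia) ((Nat.dvd_add_right dvd_rfl).1 hd)
      lia
    push_cast at hunit
    rw [add_assoc] at hunit
    refine ⟨r + binomProd (p / 3) B * (cubicCoeff p * (p + (B + p * s))⁻¹),
      add_mem hr (mul_mem (binomProd_mem_pIntegers _ _)
        (mul_mem (cubicCoeff_mem_pIntegers hp3 _) hunit.2)), ?_⟩
    rw [shift, hrec]
    linear_combination h

end congruence

theorem stmt4 (p : ℕ) (hp : p.Prime) (hp3 : 3 < p) (b : ℚ) (B : ℕ)
    (hb : isPInt p b) (hB : B < p) (hbB : pCong p 1 b (B : ℚ))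
    (hB0 : B ≠ 0) (hBlt : 3 * B < p)
    (hs : ¬ pCong p 1 ((b - B) / p) (-1)) :
    pCong p 2
      (∑ k ∈ Finset.range p,
        ((2 * k).choose k : ℚ) * ((3 * k).choose k : ℚ) / (27 ^ k * ((k : ℚ) + b)))
      ((-1 : ℚ) ^ B * ((p : ℚ) * (((b - B) / p) + 1 / 3) * (((b - B) / p) + 2 / 3)) /
        (b ^ 2 * (((b - B) / p) + 1) * ((2 * B).choose B : ℚ) *
          ((p / 3 + B).choose (p / 3 - B) : ℚ))) := by
  have hp0 : (p : ℚ) ≠ 0 := Nat.cast_ne_zero.2 hp.ne_zero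
  rw [pCong, pow_one, ← mem_pIntegers (hp := hp)] at hbB hs
  obtain ⟨s, hsdef⟩ : ∃ s, (b - B) / p = s := ⟨_, rfl⟩
  obtain rfl : b = B + p * s := by
    rw [← hsdef]
    field_simp
    ring
  rw [hsdef] at hbB hs ⊢
  rw [sub_neg_eq_add] at hs
  have hs0 : s + 1 ≠ 0 := fun h => hs (by simp [h, zero_mem])
  have hs1 := inv_mem_pIntegers (add_mem hbB (one_mem _)) hs
  obtain ⟨r, hr, h⟩ := binomProd_mul_cubicSum hp3 hbB hs0 hs1 (Nat.pos_of_ne_zero hB0) hBlt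
  have hbu := inv_intCast_add_mul_mem_pIntegers (n := B) hbB fun hd => by
    have := Int.le_of_dvd (by lia) hd
    lia
  rw [Int.cast_natCast] at hbu
  have hD := inv_binomProd_mem_pIntegers (hp := hp) (n := p / 3) (B := B) (by lia) (by lia)
  have hD0 := binomProd_ne_zero (n := p / 3) (B := B) (by lia)
  have hsum : ∑ k ∈ Finset.range p,
      ((2 * k).choose k : ℚ) * ((3 * k).choose k : ℚ) / (27 ^ k * ((k : ℚ) + (B + p * s)))
      = cubicSum p (B + p * s) :=
    Finset.sum_congr rfl fun k _ => by rw [cubicCoeff, div_div]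
  rw [hsum, mul_assoc (_ * _), ← binomProd, pCong, ← mem_pIntegers (hp := hp)]
  have hfin : (cubicSum p (B + p * s) - (-1 : ℚ) ^ B * (p * (s + 1 / 3) * (s + 2 / 3)) /
      ((B + p * s) ^ 2 * (s + 1) * binomProd (p / 3) B)) / (p : ℚ) ^ 2
      = r * (B + p * s)⁻¹ ^ 2 * (binomProd (p / 3) B)⁻¹ := by
    have hb0 := hbu.1
    generalize (B : ℚ) + p * s = b at *
    generalize cubicSum p b = F at *
    generalize binomProd (p / 3) B = D at *
    have hF : F = ((-1) ^ B * p * ((s + 1 / 3) * (s + 2 / 3) / (s + 1)) + p ^ 2 * r)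
        / (D * b ^ 2) := by
      rw [← h]
      field_simp
    rw [hF]
    field_simp
    ring
  rw [hfin]
  exact mul_mem (mul_mem hr (pow_mem hbu.2 2)) hD
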